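/- For an r-differential poset P, the rank sizes increase weakly: p_n ≥ p_{n−1} for all n ≥ 1. -/

import Mathlib

open Polynomial

/-- A rectangular matrix over a commutative ring has Smith normal form: there are
invertible matrices `P`, `Q` such that `P * A * Q` is diagonal with diagonal entries
forming a divisibility chain. -/
def Matrix.HasSNF {R : Type*} [CommRing R] {m n : ℕ} (A : Matrix (Fin m) (Fin n) R) : Prop :=
  ∃ (P : Matrix (Fin m) (Fin m) R) (Q : Matrix (Fin n) (Fin n) R),
    IsUnit P ∧ IsUnit Q ∧
    (∀ (i : Fin m) (j : Fin n), (i : ℕ) ≠ (j : ℕ) → (P * A * Q) i j = 0) ∧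
    (∀ (i : ℕ) (h₁ : i + 1 < m) (h₂ : i + 1 < n),
      (P * A * Q) ⟨i, Nat.lt_of_succ_lt h₁⟩ ⟨i, Nat.lt_of_succ_lt h₂⟩ ∣
        (P * A * Q) ⟨i + 1, h₁⟩ ⟨i + 1, h₂⟩)

/-- SNF for matrices with arbitrary finite index types. -/
def Matrix.HasSNF' {ι κ R : Type*} [Fintype ι] [Fintype κ] [CommRing R]
    (A : Matrix ι κ R) : Prop :=
  ∃ (eι : ι ≃ Fin (Fintype.card ι)) (eκ : κ ≃ Fin (Fintype.card κ)),
    Matrix.HasSNF (Matrix.reindex eι eκ A)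
/-- An endomorphism `φ` of a `ℤ`-module `M` (equivalently, the `ℤ[x]`-module `(M, φ)` where
`x` acts as `φ`) has rational canonical form over `ℤ`: `M` is an internal direct sum of
cyclic `ℤ[x]`-submodules whose annihilators are generated by monic non-constant polynomials
`a_1 ∣ a_2 ∣ ... ∣ a_k`. -/
def Module.End.HasRCF {M : Type*} [AddCommGroup M] [Module ℤ M] (φ : Module.End ℤ M) : Prop :=
  ∃ (k : ℕ) (V : Fin k → Submodule ℤ[X] (Module.AEval' φ)) (a : Fin k → ℤ[X]),
    (∀ i, (a i).Monic) ∧ (∀ i, 0 < (a i).natDegree) ∧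
    (∀ i j : Fin k, i ≤ j → a i ∣ a j) ∧
    (∀ i, ∃ v : Module.AEval' φ, V i = Submodule.span ℤ[X] {v}) ∧
    (∀ i, (V i).annihilator = Ideal.span {a i}) ∧
    DirectSum.IsInternal V
/-- An `r`-differential poset. -/
structure DiffPoset (r : ℕ) where
  P : Type
  [po : PartialOrder P]
  locallyFinite : ∀ x y : P, (Set.Icc x y).Finite
  rk : P → ℕ
  fiberFinite : ∀ n : ℕ, {x : P | rk x = n}.Finite
  bot : P
  bot_le : ∀ x : P, bot ≤ x
  rk_bot : rk bot = 0
  rk_covBy : ∀ {x y : P}, x ⋖ y → rk y = rk x + 1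
  d2 : ∀ {x y : P}, x ≠ y →
      {z : P | z ⋖ x ∧ z ⋖ y}.ncard = {z : P | x ⋖ z ∧ y ⋖ z}.ncard
  d3 : ∀ x : P, {z : P | x ⋖ z}.ncard = {z : P | z ⋖ x}.ncard + r

attribute [instance] DiffPoset.po

namespace DiffPoset

variable {r : ℕ} (D : DiffPoset r)

/-- The `n`-th rank `P_n` of the poset. -/
abbrev level (n : ℕ) : Type := {x : D.P // D.rk x = n}

noncomputable instance (n : ℕ) : Fintype (D.level n) := (D.fiberFinite n).fintype

noncomputable instance (n : ℕ) : DecidableEq (D.level n) := Classical.decEq _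

noncomputable instance (x y : D.P) : Decidable (x ⋖ y) := Classical.dec _

/-- The rank size `p_n`. -/
noncomputable def p (n : ℕ) : ℕ := Fintype.card (D.level n)

/-- The matrix of the up map `U_n` in the standard basis. -/
noncomputable def upMatrix (R : Type*) [CommRing R] (n : ℕ) :
    Matrix (D.level (n + 1)) (D.level n) R :=
  fun y x => if (x : D.P) ⋖ (y : D.P) then 1 else 0

/-- The matrix of the down map `D_{n+1}` in the standard basis. -/
noncomputable def downMatrix (R : Type*) [CommRing R] (n : ℕ) :
    Matrix (D.level n) (D.level (n + 1)) R :=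
  fun y x => if (y : D.P) ⋖ (x : D.P) then 1 else 0

/-- The up map `U_n : RP_n → RP_{n+1}`. -/
noncomputable def up (R : Type*) [CommRing R] (n : ℕ) :
    (D.level n → R) →ₗ[R] (D.level (n + 1) → R) :=
  (D.upMatrix R n).mulVecLin

/-- The down map `D_{n+1} : RP_{n+1} → RP_n`. -/
noncomputable def down (R : Type*) [CommRing R] (n : ℕ) :
    (D.level (n + 1) → R) →ₗ[R] (D.level n → R) :=
  (D.downMatrix R n).mulVecLin

/-- The operator `DU_n = D_{n+1} ∘ U_n`. -/
noncomputable def du (R : Type*) [CommRing R] (n : ℕ) :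
    Module.End R (D.level n → R) :=
  (D.down R n) ∘ₗ (D.up R n)

/-- The matrix `[DU_n]` in the standard basis. -/
noncomputable def duMatrix (R : Type*) [CommRing R] (n : ℕ) :
    Matrix (D.level n) (D.level n) R :=
  D.downMatrix R n * D.upMatrix R n

/-- The operator `UD_n = U_{n-1} ∘ D_n` (zero for `n = 0`). -/
noncomputable def ud (R : Type*) [CommRing R] : (n : ℕ) → Module.End R (D.level n → R)
  | 0 => 0
  | (n + 1) => (D.up R n) ∘ₗ (D.down R n)

/-- The matrix `[UD_n]` in the standard basis (zero for `n = 0`). -/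
noncomputable def udMatrix (R : Type*) [CommRing R] :
    (n : ℕ) → Matrix (D.level n) (D.level n) R
  | 0 => 0
  | (n + 1) => D.upMatrix R n * D.downMatrix R n

/-- The rank size difference `Δp_n = p_n - p_{n-1}` (with `p_{-1} = 0`), as an integer. -/
noncomputable def dp : ℕ → ℤ
  | 0 => (D.p 0 : ℤ)
  | (n + 1) => (D.p (n + 1) : ℤ) - (D.p n : ℤ)

/-- The rank size difference `Δp_n = p_n - p_{n-1}` (with `p_{-1} = 0`), as a natural number. -/
noncomputable def dpN : ℕ → ℕ
  | 0 => D.p 0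
  | (n + 1) => D.p (n + 1) - D.p n

end DiffPoset

namespace DiffPoset

/-- Summing the indicator of a predicate over a subtype containing it counts the predicate. -/
theorem sum_indicator_eq_ncard {α : Type*} {s q : α → Prop} [Fintype {z // s z}]
    [DecidablePred q] (h : ∀ z, q z → s z) :
    (∑ z : {z // s z}, if q z then (1 : ℚ) else 0) = ({z | q z}.ncard : ℚ) := by
  classical
  rw [Finset.sum_boole, Nat.cast_inj, ← Set.ncard_coe_finset,
    ← Set.ncard_image_of_injective _ Subtype.val_injective]
  congr 1
  ext z
  simp only [Finset.coe_filter, Finset.mem_univ, true_and, Set.mem_image, Set.mem_ofPred_eq,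
    Subtype.exists, exists_and_right, exists_eq_right]
  exact ⟨fun ⟨_, hz⟩ => hz, fun hz => ⟨h z hz, hz⟩⟩

variable {r : ℕ} (D : DiffPoset r)

/-- The elements whose rank is one less than `n`; empty for `n = 0`. -/
abbrev predLevel (n : ℕ) : Type := {x : D.P // D.rk x + 1 = n}

noncomputable instance (n : ℕ) : Fintype (D.predLevel n) :=
  ((D.fiberFinite (n - 1)).subset fun x (hx : D.rk x + 1 = n) =>
    show D.rk x = n - 1 by omega).fintype

/-- The cover matrix from the rank below `n` to rank `n`, also defined for `n = 0`. -/
noncomputable def lowerMatrix (n : ℕ) : Matrix (D.level n) (D.predLevel n) ℚ :=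
  fun x z => if (z : D.P) ⋖ (x : D.P) then 1 else 0

/-- The commutation relation `DU - UD = r`. -/
theorem transpose_upMatrix_mul_upMatrix (n : ℕ) :
    (D.upMatrix ℚ n).transpose * D.upMatrix ℚ n =
      D.lowerMatrix n * (D.lowerMatrix n).transpose + (r : ℚ) • 1 := by
  classical
  ext x y
  simp only [Matrix.mul_apply, Matrix.transpose_apply, Matrix.add_apply, Matrix.smul_apply,
    upMatrix, lowerMatrix, ite_zero_mul_ite_zero, mul_one, smul_eq_mul]
  rw [sum_indicator_eq_ncard (q := fun z => x.1 ⋖ z ∧ y.1 ⋖ z)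
      fun z hz => by rw [D.rk_covBy hz.1, x.2],
    sum_indicator_eq_ncard (q := fun z => z ⋖ x.1 ∧ z ⋖ y.1)
      fun z hz => by rw [← D.rk_covBy hz.1, x.2]]
  by_cases h : x = y
  · subst h
    simp [D.d3 x.1]
  · simp [Matrix.one_apply_ne h, D.d2 fun h' => h (Subtype.ext h')]

theorem up_injective (hr : 0 < r) (n : ℕ) : Function.Injective (D.up ℚ n) := by
  rw [injective_iff_map_eq_zero]
  intro v hv
  replace hv : (D.upMatrix ℚ n).mulVec v = 0 := hv
  have key := congrArg (fun A => v ⬝ᵥ A.mulVec v) (D.transpose_upMatrix_mul_upMatrix n)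
  simp only [Matrix.add_mulVec, ← Matrix.mulVec_mulVec, hv, Matrix.mulVec_zero,
    dotProduct_zero, dotProduct_add, Matrix.smul_mulVec, Matrix.one_mulVec,
    dotProduct_smul, smul_eq_mul, Matrix.dotProduct_mulVec v (D.lowerMatrix n),
    Matrix.mulVec_transpose] at key
  have nonneg {ι : Type} [Fintype ι] (w : ι → ℚ) : 0 ≤ w ⬝ᵥ w :=
    Finset.sum_nonneg fun i _ => mul_self_nonneg (w i)
  have h₁ := nonneg (Matrix.vecMul v (D.lowerMatrix n))
  have h₂ := nonneg v
  have hr' : (0 : ℚ) < r := by exact_mod_cast hr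
  refine dotProduct_self_eq_zero.mp (le_antisymm ?_ h₂)
  nlinarith

end DiffPoset

/-- For an `r`-differential poset, the rank sizes increase weakly:
`p_{n-1} ≤ p_n` for all `n ≥ 1`. -/
theorem rank_sizes_weakly_increasing {r : ℕ} (hr : 0 < r) (D : DiffPoset r)
    (n : ℕ) (hn : 1 ≤ n) : D.p (n - 1) ≤ D.p n := by
  obtain ⟨m, rfl⟩ := Nat.exists_eq_add_of_le' hn
  simpa [DiffPoset.p] using LinearMap.finrank_le_finrank_of_injective (D.up_injective hr m)
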